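/- arXiv:1809.00776 — 10 statements merged into one kernel-verified Lean document; each statement's English description precedes it below -/
import Mathlib

section
/- Let G be a group and let H be a proper subgroup of G. Then the action of the shift t strictly confines A = ⊕_{ℤ} G into the set Q_H = {f ∈ A : f(−i) ∈ H for all i > 0}. That is: (a) t·Q_H is a proper subset of Q_H; (b) for every f ∈ A there exists n ≥ 0 with tⁿ·f ∈ Q_H; (c) there exists an integer n₀ ≥ 0 (in fact n₀ = 0) such that t^{n₀}·(q₁q₂) ∈ Q_H for all q₁, q₂ ∈ Q_H. -/
open Function Set Pointwise

variable (G : Type*) [Group G]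

/-- The restricted direct product `⊕_{i∈ℤ} G`, as the subgroup of `ℤ → G`
consisting of functions with finite (multiplicative) support. -/
def finSupp : Subgroup (ℤ → G) where
  carrier := {f | (Function.mulSupport f).Finite}
  one_mem' := by simp [Function.mulSupport_one]
  mul_mem' := by
    intro f g hf hg
    exact (hf.union hg).subset (Function.mulSupport_mul f g)
  inv_mem' := by
    intro f hf
    simpa [Function.mulSupport_inv] using hf

/-- The shift automorphism `t` of `⊕_{i∈ℤ} G` : `(t·f)(i+1) = f(i)`. -/
def shiftAut : MulAut (finSupp G) where
  toFun f := ⟨fun i => (f : ℤ → G) (i - 1), by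
    apply (f.2.image (· + 1)).subset
    intro i hi
    exact ⟨i - 1, hi, by ring⟩⟩
  invFun f := ⟨fun i => (f : ℤ → G) (i + 1), by
    apply (f.2.image (· - 1)).subset
    intro i hi
    exact ⟨i + 1, hi, by ring⟩⟩
  left_inv f := by
    apply Subtype.ext; funext i; simp
  right_inv f := by
    apply Subtype.ext; funext i; simp
  map_mul' f g := rfl


/-- `Q_H = {f ∈ A : f(−i) ∈ H for all i > 0}`. -/
def QH (H : Subgroup G) : Set (finSupp G) :=
  {f | ∀ i : ℤ, 0 < i → (f : ℤ → G) (-i) ∈ H}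

/-- For a proper subgroup `H < G`, the shift `t` strictly confines
`A = ⊕_{ℤ} G` into `Q_H`:
(a) `t·Q_H ⊊ Q_H`; (b) every `f ∈ A` satisfies `tⁿ·f ∈ Q_H` for some `n ≥ 0`;
(c) with `n₀ = 0`, `t^{n₀}·(q₁q₂) ∈ Q_H` for all `q₁, q₂ ∈ Q_H`. -/
theorem shift_strictly_confines_QH {G : Type*} [Group G] (H : Subgroup G) (hH : H ≠ ⊤) :
    (⇑(shiftAut G) '' QH G H ⊂ QH G H) ∧
    (∀ f : finSupp G, ∃ n : ℕ, ((shiftAut G) ^ n) f ∈ QH G H) ∧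
    (∀ q₁ ∈ QH G H, ∀ q₂ ∈ QH G H, q₁ * q₂ ∈ QH G H) := by
  have happ : ∀ (f : finSupp G) (i : ℤ),
      ((shiftAut G f : finSupp G) : ℤ → G) i = (f : ℤ → G) (i - 1) := fun _ _ => rfl
  have hpow : ∀ (n : ℕ) (f : finSupp G) (i : ℤ),
      ((((shiftAut G) ^ n) f : finSupp G) : ℤ → G) i = (f : ℤ → G) (i - n) := by
    intro n
    induction n with
    | zero => intro f i; simp
    | succ k ih =>
      intro f i
      rw [pow_succ, MulAut.mul_apply, ih, happ]
      congr 1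
      push_cast
      ring
  refine ⟨⟨?_, ?_⟩, ?_, ?_⟩
  · rintro _ ⟨q, hq, rfl⟩ i hi
    rw [happ]
    have := hq (i + 1) (by omega)
    rwa [show -(i + 1) = -i - 1 by ring] at this
  · intro hsub
    apply hH
    rw [Subgroup.eq_top_iff']
    intro g
    have hfin : (Function.mulSupport (Pi.mulSingle (0 : ℤ) g : ℤ → G)).Finite :=
      (Set.finite_singleton (0 : ℤ)).subset Pi.mulSupport_mulSingle_subset
    have hmem : (⟨Pi.mulSingle (0 : ℤ) g, hfin⟩ : finSupp G) ∈ QH G H := by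
      intro i hi
      have h0 : -i ≠ 0 := by omega
      simp [Pi.mulSingle_eq_of_ne h0, H.one_mem]
    obtain ⟨q, hq, hqe⟩ := hsub hmem
    have h1 := happ q 0
    rw [hqe] at h1
    have h2 := hq 1 one_pos
    simp at h1
    rwa [← h1] at h2
  · intro f
    obtain ⟨b, hb⟩ := (show (Function.mulSupport (f : ℤ → G)).Finite from f.2).bddBelow
    refine ⟨b.natAbs, ?_⟩
    intro i hi
    rw [hpow]
    have : (f : ℤ → G) (-i - b.natAbs) = 1 := by
      by_contra hne
      have := hb (show _ ∈ Function.mulSupport (f : ℤ → G) from hne)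
      omega
    rw [this]
    exact H.one_mem
  · intro q₁ h₁ q₂ h₂ i hi
    exact H.mul_mem (h₁ i hi) (h₂ i hi)
end

section
/- Let G be a group and let H be a proper subgroup of G. Then the action of the inverse shift t⁻¹ strictly confines A = ⊕_{ℤ} G into the set Q'_H = {f ∈ A : f(i) ∈ H for all i > 0}. That is: (a) t⁻¹·Q'_H is a proper subset of Q'_H; (b) for every f ∈ A there exists n ≥ 0 with t^{−n}·f ∈ Q'_H; (c) there exists an integer n₀ ≥ 0 (in fact n₀ = 0) such that t^{−n₀}·(q₁q₂) ∈ Q'_H for all q₁, q₂ ∈ Q'_H. -/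
open Function Set Pointwise

variable (G : Type*) [Group G]

/-- `Q'_H = {f ∈ A : f(i) ∈ H for all i > 0}`. -/
def QH' (H : Subgroup G) : Set (finSupp G) :=
  {f | ∀ i : ℤ, 0 < i → (f : ℤ → G) i ∈ H}

/-- For a proper subgroup `H < G`, the inverse shift `t⁻¹` strictly
confines `A = ⊕_{ℤ} G` into `Q'_H`:
(a) `t⁻¹·Q'_H ⊊ Q'_H`; (b) every `f ∈ A` satisfies `t^{−n}·f ∈ Q'_H` for some `n ≥ 0`;
(c) with `n₀ = 0`, `t^{−n₀}·(q₁q₂) ∈ Q'_H` for all `q₁, q₂ ∈ Q'_H`. -/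
theorem inverse_shift_strictly_confines_QH' {G : Type*} [Group G] (H : Subgroup G)
    (hH : H ≠ ⊤) :
    (⇑(shiftAut G)⁻¹ '' QH' G H ⊂ QH' G H) ∧
    (∀ f : finSupp G, ∃ n : ℕ, (((shiftAut G)⁻¹) ^ n) f ∈ QH' G H) ∧
    (∀ q₁ ∈ QH' G H, ∀ q₂ ∈ QH' G H, q₁ * q₂ ∈ QH' G H) := by
  have key : ∀ (f : finSupp G) (i : ℤ), (((shiftAut G)⁻¹ f : finSupp G) : ℤ → G) i = (f : ℤ → G) (i + 1) :=
    fun f i => rfl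
  have keyn : ∀ (n : ℕ) (f : finSupp G) (i : ℤ),
      (((((shiftAut G)⁻¹) ^ n) f : finSupp G) : ℤ → G) i = (f : ℤ → G) (i + n) := by
    intro n
    induction n with
    | zero => intro f i; simp
    | succ n ih =>
      intro f i
      rw [pow_succ, MulAut.mul_apply, ih, key]
      have e : i + (n : ℤ) + 1 = i + ((n + 1 : ℕ) : ℤ) := by
        push_cast
        ring
      rw [e]
  refine ⟨⟨?_, ?_⟩, ?_, ?_⟩
  · rintro _ ⟨f, hf, rfl⟩ i hi
    rw [key]
    exact hf _ (by omega)
  · intro hsub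
    obtain ⟨g, hg⟩ : ∃ g, g ∉ H := by
      by_contra h
      push Not at h
      exact hH ((Subgroup.eq_top_iff' H).2 h)
    have hfin : (Pi.mulSingle (0 : ℤ) g : ℤ → G) ∈ finSupp G :=
      (Set.finite_singleton (0 : ℤ)).subset Pi.mulSupport_mulSingle_subset
    obtain ⟨q, hq, hqe⟩ := @hsub ⟨_, hfin⟩ (by
      intro i hi
      have : (Pi.mulSingle (0 : ℤ) g : ℤ → G) i = 1 := by
        rw [Pi.mulSingle_apply, if_neg hi.ne']
      simp [this, H.one_mem])
    have h1 := key q 0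
    rw [hqe] at h1
    have h2 := hq (0 + 1) (by norm_num)
    rw [← h1] at h2
    apply hg
    simpa using h2
  · intro f
    obtain ⟨b, hb⟩ := (show (Function.mulSupport (f : ℤ → G)).Finite from f.2).bddAbove
    refine ⟨b.toNat, fun i hi => ?_⟩
    rw [keyn]
    have : (f : ℤ → G) (i + b.toNat) = 1 := by
      by_contra h
      have := hb (show i + (b.toNat : ℤ) ∈ Function.mulSupport (f : ℤ → G) from h)
      omega
    rw [this]
    exact H.one_mem
  · intro q₁ h₁ q₂ h₂ i hi
    exact H.mul_mem (h₁ i hi) (h₂ i hi)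
end

section
/- Let G be a group and let H, K be proper subgroups of G with H not contained in K. Choose h ∈ H \ K and for each i ≥ 1 let p_i ∈ A be the function with p_i(−i) = h and p_i(j) = e for j ≠ −i. Then every p_i lies in Q_H, but for every N ∈ ℕ there exists i ≥ 1 such that p_i, viewed as an element of the wreath product G wr ℤ, is not a product of at most N elements of S_K ∪ S_K⁻¹, where S_K = Q_K ∪ {t, t⁻¹}. In particular the generating sets S_H = Q_H ∪ {t, t⁻¹} and S_K give inequivalent word metrics on G wr ℤ. -/
open Function Set Pointwise

variable (G : Type*) [Group G]

/-- The wreath product `G wr ℤ = (⊕_{i∈ℤ} G) ⋊ ℤ`. -/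
abbrev Wr := SemidirectProduct (finSupp G) (Multiplicative ℤ)
    (zpowersHom (MulAut (finSupp G)) (shiftAut G))

/-- The element `t` of the wreath product. -/
def tW : Wr G := SemidirectProduct.inr (Multiplicative.ofAdd (1 : ℤ))

/-- the generating set `S_H = Q_H ∪ {t, t⁻¹}` of `G wr ℤ`. -/
def SH (H : Subgroup G) : Set (Wr G) :=
  (SemidirectProduct.inl '' QH G H) ∪ {tW G, (tW G)⁻¹}

/-- products of at most `N` elements of `S ∪ S⁻¹`. -/
def wordBall {W : Type*} [Group W] (S : Set W) (N : ℕ) : Set W :=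
  {w | ∃ l : List W, l.length ≤ N ∧ (∀ x ∈ l, x ∈ S ∪ S⁻¹) ∧ l.prod = w}

/-- the element of `⊕_{ℤ} G` with value `g` at position `j` and identity elsewhere. -/
def delta (j : ℤ) (g : G) : finSupp G :=
  ⟨fun i => if i = j then g else 1, by
    apply (Set.finite_singleton j).subset
    intro i hi
    rw [Set.mem_singleton_iff]
    by_contra hij
    exact hi (if_neg hij)⟩

theorem wb_aux {G : Type*} [Group G] (K : Subgroup G) (l : List (Wr G))
    (hl : ∀ x ∈ l, x ∈ SH G K ∪ (SH G K)⁻¹) :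
    ∀ i : ℤ, (l.length : ℤ) < i → (l.prod.left : ℤ → G) (-i) ∈ K := by
  induction l with
  | nil => intro i _; simpa using K.one_mem
  | cons x l ih =>
    intro i hi
    have ih' := ih (fun y hy => hl y (List.mem_cons_of_mem _ hy))
    have hx := hl x List.mem_cons_self
    have hi' : (l.length : ℤ) + 1 < i := by simpa using hi
    have key : (∃ f ∈ QH G K, x = SemidirectProduct.inl f) ∨ x = tW G ∨ x = (tW G)⁻¹ := by
      rcases hx with (⟨f, hf, rfl⟩ | hx | hx) | (⟨f, hf, hx⟩ | hx | hx)
      · exact Or.inl ⟨f, hf, rfl⟩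
      · exact Or.inr (Or.inl hx)
      · exact Or.inr (Or.inr hx)
      · refine Or.inl ⟨f⁻¹, fun j hj => K.inv_mem (hf j hj), ?_⟩
        rw [map_inv, hx, inv_inv]
      · exact Or.inr (Or.inr (by rw [← hx, inv_inv]))
      · exact Or.inr (Or.inl (inv_injective hx))
    rw [List.prod_cons]
    rcases key with ⟨f, hf, rfl⟩ | rfl | rfl
    · have : ((SemidirectProduct.inl f * l.prod : Wr G)).left = f * l.prod.left := by
        simp
      rw [this]
      exact K.mul_mem (hf i (by omega)) (ih' i (by omega))
    · have : ((tW G * l.prod : Wr G)).left = shiftAut G l.prod.left := by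
        simp [tW]
      rw [this]
      have := ih' (i + 1) (by omega)
      rw [neg_add'] at this
      exact this
    · have : (((tW G)⁻¹ * l.prod : Wr G)).left = (shiftAut G)⁻¹ l.prod.left := by
        simp [tW]
      rw [this]
      have := ih' (i - 1) (by omega)
      rw [show -(i - 1) = -i + 1 by ring] at this
      exact this

/-- If `H, K` are proper subgroups of `G` with `H ⊄ K`, `h ∈ H \ K`, and
`p_i ∈ A` is the function with `p_i(−i) = h` and identity elsewhere, then every `p_i`
(for `i ≥ 1`) lies in `Q_H`, but for every `N` some `p_i` is not a product of at most
`N` elements of `S_K ∪ S_K⁻¹` in `G wr ℤ`. Hence `S_H` and `S_K` give inequivalent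
word metrics. -/
theorem QH_not_bounded_by_SK {G : Type*} [Group G] (H K : Subgroup G)
    (hH : H ≠ ⊤) (hK : K ≠ ⊤) (hHK : ¬ H ≤ K) (h : G) (hhH : h ∈ H) (hhK : h ∉ K) :
    (∀ i : ℤ, 1 ≤ i → delta G (-i) h ∈ QH G H) ∧
    (∀ N : ℕ, ∃ i : ℤ, 1 ≤ i ∧
      (SemidirectProduct.inl (delta G (-i) h) : Wr G) ∉ wordBall (SH G K) N) := by
  refine ⟨fun i _ j _ => ?_, fun N => ⟨N + 1, by omega, ?_⟩⟩
  · change (if -j = -i then h else 1) ∈ H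
    split_ifs
    · exact hhH
    · exact H.one_mem
  · rintro ⟨l, hlN, hl, hp⟩
    have := wb_aux K l hl (N + 1) (by omega)
    rw [hp] at this
    apply hhK
    have h2 : (if (-((N : ℤ) + 1)) = -((N : ℤ) + 1) then h else 1) ∈ K := this
    simpa using h2
end

section
/- Let G be a group and let H, K be proper subgroups of G. Pick g ∈ G \ H and g' ∈ G \ K. For i ≥ 1 let f_i ∈ A have f_i(−i) = g and value e elsewhere, and let p_i ∈ A have p_i(i) = g' and value e elsewhere. Then: (1) every f_i lies in Q'_K, but for every N ∈ ℕ there exists i with f_i not a product of at most N elements of S_H ∪ S_H⁻¹ in G wr ℤ; and (2) every p_i lies in Q_H, but for every N ∈ ℕ there exists i with p_i not a product of at most N elements of S'_K ∪ (S'_K)⁻¹ in G wr ℤ. Here S_H = Q_H ∪ {t, t⁻¹} and S'_K = Q'_K ∪ {t, t⁻¹}. In particular the word metrics given by S_H and S'_K on G wr ℤ are incomparable. -/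
open Function Set Pointwise

variable (G : Type*) [Group G]

/-- the generating set `S'_H = Q'_H ∪ {t, t⁻¹}` of `G wr ℤ`. -/
def SH' (H : Subgroup G) : Set (Wr G) :=
  (SemidirectProduct.inl '' QH' G H) ∪ {tW G, (tW G)⁻¹}

theorem aux_step {G : Type*} [Group G] (H : Subgroup G) (s : ℤ) (hs : s = 1 ∨ s = -1)
    (l : List (Wr G))
    (hl : ∀ x ∈ l, (∃ q : finSupp G, (∀ i : ℤ, 0 < i → (q : ℤ → G) (s * i) ∈ H) ∧
      x = SemidirectProduct.inl q) ∨ x = tW G ∨ x = (tW G)⁻¹) :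
    ∀ j : ℤ, (l.length : ℤ) < j → (l.prod.left : ℤ → G) (s * j) ∈ H := by
  induction l with
  | nil =>
    intro j hj
    simp [H.one_mem]
  | cons x l ih =>
    have ih' := ih (fun y hy => hl y (List.mem_cons_of_mem _ hy))
    intro j hj
    simp only [List.length_cons, Nat.cast_add, Nat.cast_one] at hj
    rw [List.prod_cons]
    rcases hl x List.mem_cons_self with ⟨q, hq, rfl⟩ | rfl | rfl
    · have h1 := hq j (by omega)
      have h2 := ih' j (by omega)
      simpa using H.mul_mem h1 h2
    · have h : ((tW G * l.prod).left : ℤ → G) (s * j) = (l.prod.left : ℤ → G) (s * j - 1) := by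
        have e : tW G = SemidirectProduct.inr (Multiplicative.ofAdd (1 : ℤ)) := rfl
        rw [e]
        simp [zpowersHom_apply]
        rfl
      rw [h]
      rcases hs with rfl | rfl
      · have := ih' (j - 1) (by omega)
        convert this using 2; ring
      · have := ih' (j + 1) (by omega)
        convert this using 2; ring
    · have h : (((tW G)⁻¹ * l.prod).left : ℤ → G) (s * j) =
          (l.prod.left : ℤ → G) (s * j + 1) := by
        have e : (tW G)⁻¹ = SemidirectProduct.inr (Multiplicative.ofAdd (-1 : ℤ)) := by
          rw [tW, ← map_inv]; rfl
        rw [e]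
        simp [zpowersHom_apply]
        rfl
      rw [h]
      rcases hs with rfl | rfl
      · have := ih' (j + 1) (by omega)
        convert this using 2; ring
      · have := ih' (j - 1) (by omega)
        convert this using 2; ring

theorem aux_ball {G : Type*} [Group G] (H : Subgroup G) (s : ℤ) (hs : s = 1 ∨ s = -1)
    (g : G) (hg : g ∉ H) (Q : Set (finSupp G))
    (hQ : ∀ q ∈ Q, ∀ i : ℤ, 0 < i → (q : ℤ → G) (s * i) ∈ H) (N : ℕ) :
    (SemidirectProduct.inl (delta G (s * (N + 1)) g) : Wr G) ∉
      wordBall ((SemidirectProduct.inl '' Q) ∪ {tW G, (tW G)⁻¹} : Set (Wr G)) N := by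
  rintro ⟨l, hlen, hl, hp⟩
  have h := aux_step H s hs l (by
    intro x hx
    rcases hl x hx with (⟨q, hq, rfl⟩ | h | h) | (⟨q, hq, h⟩ | h | h)
    · exact Or.inl ⟨q, hQ q hq, rfl⟩
    · exact Or.inr (Or.inl h)
    · exact Or.inr (Or.inr h)
    · refine Or.inl ⟨q⁻¹, fun i hi => H.inv_mem (hQ q hq i hi), ?_⟩
      rw [map_inv, h, inv_inv]
    · exact Or.inr (Or.inr (by rw [← h, inv_inv]))
    · exact Or.inr (Or.inl (inv_injective h))) (N + 1) (by omega)
  rw [hp] at h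
  apply hg
  simpa [delta] using h

/-- For proper subgroups `H, K < G`, `g ∈ G \ H`, `g' ∈ G \ K`:
(1) the functions `f_i` (value `g` at `−i`) all lie in `Q'_K` but are not uniformly
bounded in the word metric of `S_H`; (2) the functions `p_i` (value `g'` at `i`) all lie
in `Q_H` but are not uniformly bounded in the word metric of `S'_K`. Hence `[S_H]` and
`[S'_K]` are incomparable. -/
theorem SH_SH'_incomparable {G : Type*} [Group G] (H K : Subgroup G)
    (hH : H ≠ ⊤) (hK : K ≠ ⊤) (g g' : G) (hg : g ∉ H) (hg' : g' ∉ K) :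
    ((∀ i : ℤ, 1 ≤ i → delta G (-i) g ∈ QH' G K) ∧
      (∀ N : ℕ, ∃ i : ℤ, 1 ≤ i ∧
        (SemidirectProduct.inl (delta G (-i) g) : Wr G) ∉ wordBall (SH G H) N)) ∧
    ((∀ i : ℤ, 1 ≤ i → delta G i g' ∈ QH G H) ∧
      (∀ N : ℕ, ∃ i : ℤ, 1 ≤ i ∧
        (SemidirectProduct.inl (delta G i g') : Wr G) ∉ wordBall (SH' G K) N)) := by
  refine ⟨⟨?_, ?_⟩, ?_, ?_⟩
  · intro i hi j hj
    have : j ≠ -i := by omega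
    simp [delta, this, K.one_mem]
  · intro N
    refine ⟨N + 1, by omega, ?_⟩
    have := aux_ball H (-1) (Or.inr rfl) g hg (QH G H)
      (fun q hq i hi => by simpa using hq i hi) N
    rw [neg_one_mul] at this
    exact this
  · intro i hi j hj
    have : -j ≠ i := by omega
    simp [delta, this, H.one_mem]
  · intro N
    refine ⟨N + 1, by omega, ?_⟩
    have := aux_ball K 1 (Or.inl rfl) g' hg' (QH' G K)
      (fun q hq i hi => by simpa using hq i hi) N
    rw [one_mul] at this
    exact this
end

section
/- There exists a family (c_r)_{r ∈ ℝ} of proper subgroups of the free group F₂ on two generators such that for all real numbers s < r one has c_s strictly contained in c_r. In other words, the poset of proper subgroups of F₂ ordered by inclusion contains a chain of cardinality continuum. -/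
theorem f2_aux_shift (n k : ℤ) : ((Equiv.addRight (2:ℤ)) ^ n : Equiv.Perm ℤ) k = k + 2 * n := by
  induction n generalizing k with
  | zero => simp
  | succ i ih => rw [zpow_add_one, Equiv.Perm.mul_apply, ih, Equiv.coe_addRight]; ring
  | pred i ih =>
    rw [zpow_sub_one, Equiv.Perm.mul_apply, ih, Equiv.Perm.inv_def, Equiv.addRight_symm,
      Equiv.coe_addRight]
    ring

/-- The poset of proper subgroups of the free group `F₂` on two
generators contains a chain of cardinality continuum: there is a family `(c_r)_{r ∈ ℝ}`
of proper subgroups with `c_s < c_r` whenever `s < r`. -/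
theorem properSubgroups_freeGroup_two_continuum_chain :
    ∃ c : ℝ → Subgroup (FreeGroup (Fin 2)),
      (∀ r : ℝ, c r ≠ ⊤) ∧ ∀ s r : ℝ, s < r → c s < c r := by
  let e : ℤ ≃ ℚ := Denumerable.equiv₂ ℤ ℚ
  let φ : FreeGroup (Fin 2) →* Equiv.Perm ℤ :=
    FreeGroup.lift ![Equiv.swap 0 1, Equiv.addRight 2]
  let c : ℝ → Subgroup (FreeGroup (Fin 2)) := fun r =>
    ⨅ n : {n : ℤ // r ≤ (e n : ℝ)}, (MulAction.stabilizer (Equiv.Perm ℤ) (2 * n.1)).comap φ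
  have hc : ∀ r g, g ∈ c r ↔ ∀ n : ℤ, r ≤ (e n : ℝ) → φ g (2 * n) = 2 * n := by
    intro r g
    simp [c, Subgroup.mem_iInf, MulAction.mem_stabilizer_iff]
  have key : ∀ s r : ℝ, s < r → c s < c r := by
    intro s r hsr
    obtain ⟨q, hq1, hq2⟩ := exists_rat_btwn hsr
    let x : ℤ → FreeGroup (Fin 2) := fun n =>
      FreeGroup.of 1 ^ n * FreeGroup.of 0 * FreeGroup.of 1 ^ (-n)
    have hx : ∀ n m : ℤ, φ (x n) (2 * m) = Equiv.swap 0 1 (2 * m + 2 * (-n)) + 2 * n := by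
      intro n m
      simp only [x, φ, map_mul, map_zpow, FreeGroup.lift_apply_of, Equiv.Perm.mul_apply,
        Matrix.cons_val_one, Matrix.cons_val_zero, f2_aux_shift]
    refine SetLike.lt_iff_le_and_exists.2 ⟨?_, x (e.symm q), ?_, ?_⟩
    · intro g hg
      rw [hc] at hg ⊢
      exact fun n hn => hg n (hsr.le.trans hn)
    · rw [hc]
      intro n hn
      have hne : n ≠ e.symm q := by
        rintro rfl
        rw [e.apply_symm_apply] at hn
        linarith
      rw [hx, Equiv.swap_apply_of_ne_of_ne] <;> omega
    · rw [hc]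
      intro h
      have := h (e.symm q) (by rw [e.apply_symm_apply]; exact hq1.le)
      rw [hx, show 2 * e.symm q + 2 * (-e.symm q) = 0 by ring, Equiv.swap_apply_left] at this
      omega
  exact ⟨c, fun r => (lt_of_lt_of_le (key r (r + 1) (by linarith)) le_top).ne, key⟩
end

section
/- Fix n ≥ 2 and let Q ⊆ R be such that the action of t strictly confines R into Q. Let (f_j)_{j ≥ 1} be a collection of elements of B₊ \ Q for which there exists a constant K ≥ 1 with t^K f_j ∈ Q for all j ≥ 1. Let P = {t^i f_j : j ≥ 1, i ≥ 0} and Q̄ = Q ∪ P. Then: (1) the action of t strictly confines R into Q̄; and (2) there exists N ∈ ℕ such that, in the lamplighter group L_n, every element of Q̄ is a product of at most N elements of S ∪ S⁻¹, where S = Q ∪ {t, t⁻¹}. In particular the generating sets Q ∪ {t, t⁻¹} and Q̄ ∪ {t, t⁻¹} of L_n give bi-Lipschitz equivalent word metrics. -/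
open Function Set Pointwise

/-- The base `A = ⊕_{i∈ℤ} ℤ_n` of the lamplighter group, identified with the additive
group of the Laurent polynomial ring `R = ℤ_n[t, t⁻¹]` (a Laurent polynomial is its
finitely supported coefficient function `ℤ →₀ ℤ_n`). -/
abbrev Rn (n : ℕ) := ℤ →₀ ZMod n

/-- Multiplication by `t^m` on `R = ℤ_n[t, t⁻¹]`: the coefficient of `t^j` in `t^m·p`
is the coefficient of `t^{j−m}` in `p`. -/
def tmul (n : ℕ) (m : ℤ) : Rn n ≃+ Rn n :=
  Finsupp.domCongr (Equiv.addRight m)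

/-- `B₊`: the set of Laurent polynomials all of whose exponents are `≥ 0`. -/
def Bplus (n : ℕ) : Set (Rn n) := {p | ∀ i : ℤ, i < 0 → p i = 0}

/-- The action of `t` confines `R` into `Q`: (a) `tQ ⊆ Q`; (b) every `p ∈ R` has
`t^m p ∈ Q` for some `m ≥ 0`; (c) `t^{n₀}(Q + Q) ⊆ Q` for some `n₀ ≥ 0`. -/
def ConfinesT (n : ℕ) (Q : Set (Rn n)) : Prop :=
  (∀ q ∈ Q, tmul n 1 q ∈ Q) ∧
  (∀ p : Rn n, ∃ m : ℕ, tmul n m p ∈ Q) ∧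
  (∃ n₀ : ℕ, ∀ q₁ ∈ Q, ∀ q₂ ∈ Q, tmul n n₀ (q₁ + q₂) ∈ Q)

/-- Strictly confining: moreover `tQ` is a proper subset of `Q`. -/
def StrictlyConfinesT (n : ℕ) (Q : Set (Rn n)) : Prop :=
  ConfinesT n Q ∧ ⇑(tmul n 1) '' Q ⊂ Q

/-- The lamplighter group `L_n = ℤ_n wr ℤ = (⊕_{ℤ} ℤ_n) ⋊ ℤ`, where the generator `t`
of `ℤ` acts on the base by the shift (= multiplication by `t`). -/
abbrev Ln (n : ℕ) := SemidirectProduct (Multiplicative (Rn n)) (Multiplicative ℤ)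
  (zpowersHom (MulAut (Multiplicative (Rn n))) (AddEquiv.toMultiplicative (tmul n 1)))

/-- The element `t` of the lamplighter group. -/
noncomputable def tL (n : ℕ) : Ln n := SemidirectProduct.inr (Multiplicative.ofAdd (1 : ℤ))

/-- The embedding of the base `A = R` into the lamplighter group. -/
noncomputable def ι (n : ℕ) (p : Rn n) : Ln n := SemidirectProduct.inl (Multiplicative.ofAdd p)

/-- the generating set `S = Q ∪ {t, t⁻¹}` of `L_n` associated with `Q ⊆ R`. -/
def Sgen (n : ℕ) (Q : Set (Rn n)) : Set (Ln n) :=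
  (ι n '' Q) ∪ {tL n, (tL n)⁻¹}

theorem tmul_tmul (n : ℕ) (a b : ℤ) (p : Rn n) : tmul n a (tmul n b p) = tmul n (b + a) p := by
  ext i
  simp only [tmul, Finsupp.domCongr_apply, Finsupp.equivMapDomain_apply, Equiv.addRight_symm,
    Equiv.coe_addRight]
  congr 1
  ring

theorem tmul_zero' (n : ℕ) (p : Rn n) : tmul n 0 p = p := by
  ext i
  simp [tmul, Finsupp.equivMapDomain_apply]
  rfl

theorem iota_tmul (n : ℕ) (p : Rn n) : ι n p = (tL n)⁻¹ * ι n (tmul n 1 p) * tL n := by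
  have h : ι n (tmul n 1 p) = tL n * ι n p * (tL n)⁻¹ := by
    have := SemidirectProduct.inl_aut (φ := zpowersHom (MulAut (Multiplicative (Rn n)))
      (AddEquiv.toMultiplicative (tmul n 1))) (Multiplicative.ofAdd (1 : ℤ))
      (Multiplicative.ofAdd p)
    rw [map_inv] at this
    unfold ι tL
    rw [← this]
    simp [zpowersHom_apply]
  rw [h]
  group

theorem ball_step (n : ℕ) (Q : Set (Rn n)) (N : ℕ) (p : Rn n)
    (h : ι n (tmul n 1 p) ∈ wordBall (Sgen n Q) N) : ι n p ∈ wordBall (Sgen n Q) (N + 2) := by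
  obtain ⟨l, hl, hS, hp⟩ := h
  refine ⟨(tL n)⁻¹ :: (l ++ [tL n]), by simp; omega, ?_, ?_⟩
  · intro x hx
    simp only [List.mem_cons, List.mem_append, List.not_mem_nil, or_false] at hx
    rcases hx with rfl | hx | rfl
    · left; right; simp
    · exact hS x hx
    · left; right; simp
  · rw [iota_tmul, ← hp]
    simp [mul_assoc]

theorem ball_pow (n : ℕ) (Q : Set (Rn n)) (K : ℕ) : ∀ p : Rn n, tmul n (K : ℤ) p ∈ Q →
    ι n p ∈ wordBall (Sgen n Q) (2 * K + 1) := by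
  induction K with
  | zero =>
    intro p hp
    rw [Nat.cast_zero, tmul_zero'] at hp
    exact ⟨[ι n p], by simp, by
      intro x hx
      rw [List.mem_singleton] at hx
      subst hx
      exact Or.inl (Or.inl ⟨p, hp, rfl⟩), by simp⟩
  | succ k ih =>
    intro p hp
    apply ball_step n Q (2 * k + 1)
    apply ih
    rw [tmul_tmul]
    rw [add_comm]
    exact_mod_cast hp

theorem tmul_mem_nat (n : ℕ) (Q : Set (Rn n)) (h : ∀ q ∈ Q, tmul n 1 q ∈ Q) (m : ℕ) :
    ∀ q ∈ Q, tmul n (m : ℤ) q ∈ Q := by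
  induction m with
  | zero => intro q hq; rwa [Nat.cast_zero, tmul_zero']
  | succ k ih =>
    intro q hq
    have := h _ (ih q hq)
    rw [tmul_tmul] at this
    exact_mod_cast this

/-- If `t` strictly confines `R` into `Q`, and `(f_j)_{j≥1}` is a family
of elements of `B₊ \ Q` with `t^K f_j ∈ Q` for all `j` (for a fixed `K ≥ 1`), then with
`P = {t^i f_j}` and `Q̄ = Q ∪ P`: (1) `t` strictly confines `R` into `Q̄`; (2) `Q̄` is
uniformly bounded in the word metric on `L_n` given by `S = Q ∪ {t, t⁻¹}`. In particular
`Q ∪ {t, t⁻¹}` and `Q̄ ∪ {t, t⁻¹}` give bi-Lipschitz equivalent word metrics. -/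
theorem enlarge_confining_by_family (n : ℕ) (hn : 2 ≤ n) (Q : Set (Rn n))
    (hQ : StrictlyConfinesT n Q) (f : ℕ → Rn n) (hf : ∀ j, f j ∈ Bplus n \ Q)
    (K : ℕ) (hK : 1 ≤ K) (hfK : ∀ j, tmul n (K : ℤ) (f j) ∈ Q) :
    StrictlyConfinesT n (Q ∪ {p | ∃ (j : ℕ) (i : ℕ), p = tmul n (i : ℤ) (f j)}) ∧
    ∃ N : ℕ, ∀ p ∈ Q ∪ {p | ∃ (j : ℕ) (i : ℕ), p = tmul n (i : ℤ) (f j)},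
      ι n p ∈ wordBall (Sgen n Q) N := by
  obtain ⟨⟨ha, hb, n₀, hc⟩, -⟩ := hQ
  set Q' : Set (Rn n) := Q ∪ {p | ∃ (j : ℕ) (i : ℕ), p = tmul n (i : ℤ) (f j)} with hQ'
  have hKQ : ∀ p ∈ Q', tmul n (K : ℤ) p ∈ Q := by
    rintro p (hp | ⟨j, i, rfl⟩)
    · exact tmul_mem_nat n Q ha K p hp
    · rw [tmul_tmul, add_comm, ← tmul_tmul]
      exact tmul_mem_nat n Q ha i _ (hfK j)
  have ha' : ∀ q ∈ Q', tmul n 1 q ∈ Q' := by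
    rintro p (hp | ⟨j, i, rfl⟩)
    · exact Or.inl (ha p hp)
    · refine Or.inr ⟨j, i + 1, ?_⟩
      rw [tmul_tmul]
      push_cast
      rfl
  refine ⟨⟨⟨ha', ?_, K + n₀, ?_⟩, ?_, ?_⟩, 2 * K + 1, fun p hp => ball_pow n Q K p (hKQ p hp)⟩
  · intro p
    obtain ⟨m, hm⟩ := hb p
    exact ⟨m, Or.inl hm⟩
  · intro q₁ h₁ q₂ h₂
    left
    have := hc _ (hKQ q₁ h₁) _ (hKQ q₂ h₂)
    rw [← map_add, tmul_tmul] at this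
    exact_mod_cast this
  · rintro _ ⟨q, hq, rfl⟩
    exact ha' q hq
  · intro hsub
    have key : ∀ m : ℕ, ∀ p ∈ Q', ∃ q ∈ Q', tmul n (m : ℤ) q = p := by
      intro m
      induction m with
      | zero => intro p hp; exact ⟨p, hp, by rw [Nat.cast_zero, tmul_zero']⟩
      | succ k ih =>
        intro p hp
        obtain ⟨q, hq, rfl⟩ := ih p hp
        obtain ⟨r, hr, rfl⟩ := hsub hq
        refine ⟨r, hr, ?_⟩
        rw [tmul_tmul, add_comm]
        push_cast
        rfl
    obtain ⟨q, hq, h⟩ := key K (f 0) (Or.inr ⟨0, 0, by rw [Nat.cast_zero, tmul_zero']⟩)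
    exact (hf 0).2 (h ▸ hKQ q hq)
end

section
/- Fix n ≥ 2 and let Q ⊆ R be such that the action of t confines R into Q. Let H be the subgroup of ℤ_n generated by the set of all g ∈ ℤ_n such that g appears as a coefficient with arbitrarily small negative exponents in elements of Q (i.e., for every N ≥ 0 there exist p ∈ Q and i ≥ N such that the coefficient of t^{−i} in p equals g). Then there exists an integer M ≥ 0 such that t^M q ∈ Q_H for every q ∈ Q, where Q_H = {p ∈ R : the coefficient of t^{−i} in p lies in H for all i ≥ 1}. -/
open Function Set Pointwise

/-- The subgroup `H ≤ ℤ_n` generated by all coefficients appearing with arbitrarily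
small negative exponents in elements of `Q`. -/
def Hgen (n : ℕ) (Q : Set (Rn n)) : AddSubgroup (ZMod n) :=
  AddSubgroup.closure {g | ∀ N : ℕ, ∃ p ∈ Q, ∃ i : ℕ, N ≤ i ∧ p (-(i : ℤ)) = g}

/-- `Q_H = {p ∈ R : the coefficient of t^{−i} in p lies in H for all i ≥ 1}`. -/
def QHlamp (n : ℕ) (H : AddSubgroup (ZMod n)) : Set (Rn n) :=
  {p | ∀ i : ℤ, 1 ≤ i → p (-i) ∈ H}

/-- If `t` confines `R` into `Q` and `H` is the subgroup of `ℤ_n`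
generated by the coefficients appearing with arbitrarily small negative exponents in
elements of `Q`, then `t^M Q ⊆ Q_H` for some `M ≥ 0`. -/
theorem tM_Q_subset_QH (n : ℕ) (hn : 2 ≤ n) (Q : Set (Rn n)) (hQ : ConfinesT n Q) :
    ∃ M : ℕ, ∀ q ∈ Q, tmul n (M : ℤ) q ∈ QHlamp n (Hgen n Q) := by
  classical
  haveI : NeZero n := ⟨by omega⟩
  have key : ∀ g : ZMod n, ∃ N : ℕ, g ∈ Hgen n Q ∨
      ∀ p ∈ Q, ∀ i : ℕ, N ≤ i → p (-(i : ℤ)) ≠ g := by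
    intro g
    by_cases hg : ∀ N : ℕ, ∃ p ∈ Q, ∃ i : ℕ, N ≤ i ∧ p (-(i : ℤ)) = g
    · exact ⟨0, Or.inl (AddSubgroup.subset_closure hg)⟩
    · push Not at hg
      obtain ⟨N, hN⟩ := hg
      exact ⟨N, Or.inr hN⟩
  choose N hN using key
  refine ⟨Finset.univ.sup N, fun q hq i hi => ?_⟩
  set M := Finset.univ.sup N with hM
  have h1 : tmul n (M : ℤ) q (-i) = q (-((i.toNat + M : ℕ) : ℤ)) := by
    simp only [tmul, Finsupp.domCongr_apply, Finsupp.equivMapDomain_apply,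
      Equiv.addRight_symm, Equiv.coe_addRight]
    congr 1
    omega
  rw [h1]
  rcases hN (q (-((i.toNat + M : ℕ) : ℤ))) with h | h
  · exact h
  · have hle : N (q (-((i.toNat + M : ℕ) : ℤ))) ≤ M :=
      Finset.le_sup (f := N) (Finset.mem_univ _)
    exact absurd rfl (h q hq (i.toNat + M) (by omega))
end

section
/- Fix n ≥ 2 and let Q ⊆ R be such that the action of t strictly confines R into Q and B₊ ⊆ Q. Let H be the subgroup of ℤ_n generated by the set of all g ∈ ℤ_n such that g appears as a coefficient with arbitrarily small negative exponents in elements of Q (i.e., for every N ≥ 0 there exist p ∈ Q and i ≥ N such that the coefficient of t^{−i} in p equals g). Then Q̃_H ⊆ Q, where Q̃_H = {p ∈ R : the coefficient of t^{−i} in p lies in H for all i ≥ 1, and the coefficient of t^{j} in p is 0 for all j ≥ 0}. -/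
open Function Set Pointwise

/-- `Q̃_H`: elements supported on negative exponents with all coefficients in `H`. -/
def QtildeH (n : ℕ) (H : AddSubgroup (ZMod n)) : Set (Rn n) :=
  {p | (∀ i : ℤ, 1 ≤ i → p (-i) ∈ H) ∧ (∀ j : ℤ, 0 ≤ j → p j = 0)}

theorem tmul_apply' (n : ℕ) (m : ℤ) (p : Rn n) (j : ℤ) : tmul n m p j = p (j - m) := by
  simp [tmul, Finsupp.domCongr, sub_eq_add_neg]

/-- power series all of whose truncations occur arbitrarily deep in `Q`. -/
def VV (n : ℕ) (Q : Set (Rn n)) : Set (PowerSeries (ZMod n)) :=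
  {f | ∀ L : ℕ, ∃ q ∈ Q, (∀ j : ℤ, j < -(L : ℤ) → q j = 0) ∧
    ∀ k : ℕ, k < L → q ((k : ℤ) - L) = PowerSeries.coeff k f}

theorem VV_zero {n : ℕ} {Q : Set (Rn n)} (hB : Bplus n ⊆ Q) : (0 : PowerSeries (ZMod n)) ∈ VV n Q := by
  intro L
  refine ⟨0, hB (fun i _ => rfl), fun _ _ => rfl, ?_⟩
  simp

theorem VV_add {n : ℕ} {Q : Set (Rn n)} (n₀ : ℕ)
    (h0 : ∀ q₁ ∈ Q, ∀ q₂ ∈ Q, tmul n n₀ (q₁ + q₂) ∈ Q)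
    {f g : PowerSeries (ZMod n)} (hf : f ∈ VV n Q) (hg : g ∈ VV n Q) : f + g ∈ VV n Q := by
  intro L
  obtain ⟨q, hq, h1, h2⟩ := hf (L + n₀)
  obtain ⟨r, hr, h3, h4⟩ := hg (L + n₀)
  refine ⟨_, h0 q hq r hr, ?_, ?_⟩
  · intro j hj
    rw [tmul_apply', Finsupp.add_apply, h1 _ (by push_cast; omega), h3 _ (by push_cast; omega), add_zero]
  · intro k hk
    have e : (k : ℤ) - L - n₀ = k - ((L + n₀ : ℕ) : ℤ) := by push_cast; ring
    rw [tmul_apply', Finsupp.add_apply, e, h2 k (by omega), h4 k (by omega), map_add]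

theorem VV_X {n : ℕ} {Q : Set (Rn n)} (ht : ∀ q ∈ Q, tmul n 1 q ∈ Q)
    {f : PowerSeries (ZMod n)} (hf : f ∈ VV n Q) : PowerSeries.X * f ∈ VV n Q := by
  intro L
  obtain ⟨q, hq, h1, h2⟩ := hf L
  refine ⟨_, ht q hq, ?_, ?_⟩
  · intro j hj
    rw [tmul_apply', h1 _ (by omega)]
  · intro k hk
    rw [tmul_apply']
    cases k with
    | zero => rw [h1 _ (by push_cast; omega)]; simp
    | succ k =>
      rw [PowerSeries.coeff_succ_X_mul, ← h2 k (by omega)]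
      congr 1; push_cast; ring

theorem VV_unX {n : ℕ} {Q : Set (Rn n)}
    {f : PowerSeries (ZMod n)} (hf : PowerSeries.X * f ∈ VV n Q) : f ∈ VV n Q := by
  intro L
  obtain ⟨q, hq, h1, h2⟩ := hf (L + 1)
  refine ⟨q, hq, ?_, ?_⟩
  · intro j hj
    by_cases hj' : j < -((L + 1 : ℕ) : ℤ)
    · exact h1 j hj'
    · have := h2 0 (by omega)
      have e : j = ((0 : ℕ) : ℤ) - ((L + 1 : ℕ) : ℤ) := by push_cast at *; omega
      rw [e, this]; simp
  · intro k hk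
    rw [← PowerSeries.coeff_succ_X_mul, ← h2 (k + 1) (by omega)]
    congr 1; push_cast; ring

theorem VV_closed {n : ℕ} {Q : Set (Rn n)} {f : PowerSeries (ZMod n)}
    (h : ∀ L : ℕ, ∃ g ∈ VV n Q, ∀ k < L, PowerSeries.coeff k f = PowerSeries.coeff k g) :
    f ∈ VV n Q := by
  intro L
  obtain ⟨g, hg, hfg⟩ := h L
  obtain ⟨q, hq, h1, h2⟩ := hg L
  exact ⟨q, hq, h1, fun k hk => by rw [h2 k hk, hfg k hk]⟩

theorem VV_polymul {n : ℕ} [NeZero n] {Q : Set (Rn n)} (hB : Bplus n ⊆ Q)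
    (ht : ∀ q ∈ Q, tmul n 1 q ∈ Q) (n₀ : ℕ)
    (h0 : ∀ q₁ ∈ Q, ∀ q₂ ∈ Q, tmul n n₀ (q₁ + q₂) ∈ Q) (P : Polynomial (ZMod n))
    {f : PowerSeries (ZMod n)} (hf : f ∈ VV n Q) : (P : PowerSeries (ZMod n)) * f ∈ VV n Q := by
  induction P using Polynomial.induction_on' with
  | add p q hp hq => rw [Polynomial.coe_add, add_mul]; exact VV_add n₀ h0 hp hq
  | monomial k a =>
    have hC : ∀ m : ℕ, (m : PowerSeries (ZMod n)) * f ∈ VV n Q := by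
      intro m
      induction m with
      | zero => simpa using VV_zero hB
      | succ m ih => rw [Nat.cast_succ, add_mul, one_mul]; exact VV_add n₀ h0 ih hf
    have hX : ∀ (m : ℕ) (g : PowerSeries (ZMod n)), g ∈ VV n Q → PowerSeries.X ^ m * g ∈ VV n Q := by
      intro m
      induction m with
      | zero => intro g hg; simpa using hg
      | succ m ih => intro g hg; rw [pow_succ, mul_assoc]; exact ih _ (VV_X ht hg)
    have : ((Polynomial.monomial k a : Polynomial (ZMod n)) : PowerSeries (ZMod n)) * f
        = PowerSeries.X ^ k * (((a.val : ℕ) : PowerSeries (ZMod n)) * f) := by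
      rw [← Polynomial.C_mul_X_pow_eq_monomial]
      have e : ((a.val : ℕ) : PowerSeries (ZMod n)) = PowerSeries.C a := by
        rw [← map_natCast (PowerSeries.C (R := ZMod n)), ZMod.natCast_zmod_val]
      rw [e]
      push_cast
      ring
    rw [this]
    exact hX _ _ (hC _)

/-- `VV` as an ideal. -/
def VI {n : ℕ} [NeZero n] {Q : Set (Rn n)} (hB : Bplus n ⊆ Q)
    (ht : ∀ q ∈ Q, tmul n 1 q ∈ Q) (n₀ : ℕ)
    (h0 : ∀ q₁ ∈ Q, ∀ q₂ ∈ Q, tmul n n₀ (q₁ + q₂) ∈ Q) : Ideal (PowerSeries (ZMod n)) where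
  carrier := VV n Q
  zero_mem' := VV_zero hB
  add_mem' := fun ha hb => VV_add n₀ h0 ha hb
  smul_mem' := by
    intro h f hf
    refine VV_closed fun L => ⟨_, VV_polymul hB ht n₀ h0 (PowerSeries.trunc L h) hf, ?_⟩
    intro k hk
    rw [smul_eq_mul, PowerSeries.coeff_mul, PowerSeries.coeff_mul]
    refine Finset.sum_congr rfl fun x hx => ?_
    have := Finset.HasAntidiagonal.mem_antidiagonal.1 hx
    rw [Polynomial.coeff_coe, PowerSeries.coeff_trunc, if_pos (by omega)]

theorem arith {n : ℕ} (I : Ideal (ZMod n)) (p : ℕ) (hp : p.Prime) (c c' : ZMod n)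
    (hc : c ∉ I) (h1 : (p : ZMod n) * c ∈ I) (h2 : (p : ZMod n) * c' ∈ I) :
    ∃ a : ZMod n, c' - a * c ∈ I := by
  obtain ⟨z, rfl⟩ := ZMod.intCast_surjective c
  obtain ⟨z', rfl⟩ := ZMod.intCast_surjective c'
  obtain ⟨d, hd⟩ := IsPrincipalIdealRing.principal (I.comap (Int.castRingHom (ZMod n)))
  have key : ∀ y : ℤ, (y : ZMod n) ∈ I ↔ d ∣ y := by
    intro y
    rw [← Ideal.mem_span_singleton]
    change _ ↔ y ∈ Submodule.span ℤ {d}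
    rw [← hd]; simp [Ideal.mem_comap]
  have h1' : d ∣ p * z := by rw [← key]; push_cast; exact h1
  have h2' : d ∣ p * z' := by rw [← key]; push_cast; exact h2
  rw [key] at hc
  have hpZ : Prime (p : ℤ) := Nat.prime_iff_prime_int.1 hp
  have hpd : (p : ℤ) ∣ d := by
    by_contra hnd
    exact hc ((((Prime.coprime_iff_not_dvd hpZ).2 hnd).symm).dvd_of_dvd_mul_left h1')
  obtain ⟨e, rfl⟩ := hpd
  have hp0 : (p : ℤ) ≠ 0 := hpZ.ne_zero
  obtain ⟨u, rfl⟩ := (mul_dvd_mul_iff_left hp0).1 h1'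
  obtain ⟨u', rfl⟩ := (mul_dvd_mul_iff_left hp0).1 h2'
  have hu : ¬ (p : ℤ) ∣ u := by
    intro ⟨w, hw⟩
    exact hc ⟨w, by rw [hw]; ring⟩
  obtain ⟨s, t, hst⟩ := (Prime.coprime_iff_not_dvd hpZ).2 hu
  refine ⟨((u' * t : ℤ) : ZMod n), ?_⟩
  rw [← Int.cast_mul, ← Int.cast_sub, key]
  exact ⟨u' * s, by linear_combination (-e * u') * hst⟩

theorem mem_of_coeffs {n : ℕ} (V : Ideal (PowerSeries (ZMod n))) (f : PowerSeries (ZMod n))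
    (hf : ∀ k, PowerSeries.C (PowerSeries.coeff k f) ∈ V) : f ∈ V := by
  have hPI : IsPrincipalIdealRing (ZMod n) :=
    IsPrincipalIdealRing.of_surjective (Int.castRingHom (ZMod n)) (ZMod.ringHom_surjective _)
  obtain ⟨d, hd⟩ := hPI.principal (V.comap (PowerSeries.C (R := ZMod n)))
  have hdV : PowerSeries.C d ∈ V := by
    have : d ∈ V.comap (PowerSeries.C (R := ZMod n)) := by
      rw [hd]; exact Submodule.mem_span_singleton_self d
    exact this
  have : ∀ k, ∃ a, a * d = PowerSeries.coeff k f := by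
    intro k
    have h : PowerSeries.coeff k f ∈ V.comap (PowerSeries.C (R := ZMod n)) := hf k
    rw [hd] at h
    exact Submodule.mem_span_singleton.1 h
  choose a ha using this
  have : f = PowerSeries.mk a * PowerSeries.C d := by
    ext k
    simp [ha]
  rw [this]
  exact V.mul_mem_left _ hdV

theorem sat_ideal {n : ℕ} [NeZero n] (V : Ideal (PowerSeries (ZMod n)))
    (hX : ∀ f, PowerSeries.X * f ∈ V → f ∈ V) (f : PowerSeries (ZMod n)) (hf : f ∈ V) (k : ℕ) :
    PowerSeries.C (PowerSeries.coeff k f) ∈ V := by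
  classical
  by_contra hk
  -- choose the minimal multiple
  have hex : ∃ m : ℕ, 0 < m ∧ ∀ k, PowerSeries.C (PowerSeries.coeff k ((m : PowerSeries (ZMod n)) * f)) ∈ V := by
    refine ⟨n, Nat.pos_of_ne_zero (NeZero.ne n), fun k => ?_⟩
    have : ((n : ℕ) : PowerSeries (ZMod n)) = 0 := by
      rw [← map_natCast (PowerSeries.C (R := ZMod n))]; simp
    rw [this]; simp
  obtain ⟨hm0, hm⟩ := Nat.find_spec hex
  set m := Nat.find hex with hmdef
  have hm1 : m ≠ 1 := by
    intro h
    rw [h] at hm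
    exact hk (by simpa using hm k)
  obtain ⟨p, hp, r, hr⟩ := Nat.exists_prime_and_dvd hm1
  have hr0 : 0 < r := by
    rcases Nat.eq_zero_or_pos r with h | h
    · rw [h] at hr; omega
    · exact h
  have hrm : r < m := by rw [hr]; nlinarith [hp.two_le]
  have hnot := Nat.find_min hex hrm
  push Not at hnot
  have hnot := hnot hr0
  -- first bad coefficient
  set F := (r : PowerSeries (ZMod n)) * f with hF
  have hFV : F ∈ V := V.mul_mem_left _ hf
  set e := Nat.find hnot with he
  have he1 := Nat.find_spec hnot
  have he2 : ∀ j < e, PowerSeries.C (PowerSeries.coeff j F) ∈ V := by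
    intro j hj
    have := Nat.find_min hnot hj
    simpa using this
  have hpF : ∀ j, PowerSeries.C ((p : ZMod n) * PowerSeries.coeff j F) ∈ V := by
    intro j
    have := hm j
    rw [hr, Nat.cast_mul, mul_assoc, ← hF] at this
    rw [← map_natCast (PowerSeries.C (R := ZMod n)), PowerSeries.coeff_C_mul] at this
    exact this
  -- tail
  set G : PowerSeries (ZMod n) := PowerSeries.mk fun j => PowerSeries.coeff (j + e) F with hG
  have hGV : G ∈ V := by
    have hsplit : F = (PowerSeries.trunc e F : PowerSeries (ZMod n)) + PowerSeries.X ^ e * G := by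
      ext j
      rw [map_add, Polynomial.coeff_coe, PowerSeries.coeff_trunc, PowerSeries.coeff_X_pow_mul']
      by_cases hj : j < e
      · simp [hj, not_le.2 hj]
      · simp [hj, not_lt.1 hj, hG]
    have ht : (PowerSeries.trunc e F : PowerSeries (ZMod n)) ∈ V := by
      apply mem_of_coeffs
      intro j
      rw [Polynomial.coeff_coe, PowerSeries.coeff_trunc]
      split_ifs with hj
      · exact he2 j hj
      · simp
    have h3 : PowerSeries.X ^ e * G ∈ V := by
      rw [hsplit] at hFV
      exact (V.add_mem_iff_right ht).1 hFV
    have h4 : ∀ i : ℕ, PowerSeries.X ^ i * G ∈ V → G ∈ V := by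
      intro i
      induction i with
      | zero => intro h; simpa using h
      | succ i ih => intro h; rw [pow_succ', mul_assoc] at h; exact ih (hX _ h)
    exact h4 e h3
  have hc : ∀ j, ∃ a : ZMod n, PowerSeries.coeff (j + e) F - a * PowerSeries.coeff e F ∈
      V.comap (PowerSeries.C (R := ZMod n)) :=
    fun j => arith _ p hp _ _ he1 (hpF e) (hpF (j + e))
  choose a ha using hc
  set h : PowerSeries (ZMod n) := PowerSeries.mk fun j => if j = 0 then 1 else a j with hh
  have hu : IsUnit h := by
    rw [PowerSeries.isUnit_iff_constantCoeff]
    simp [hh, ← PowerSeries.coeff_zero_eq_constantCoeff_apply]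
  have hd : G - h * PowerSeries.C (PowerSeries.coeff e F) ∈ V := by
    apply mem_of_coeffs
    intro j
    rw [map_sub, PowerSeries.coeff_mul_C, hG, hh, PowerSeries.coeff_mk, PowerSeries.coeff_mk]
    by_cases hj : j = 0
    · simp [hj]
    · rw [if_neg hj]; exact ha j
  have h5 : h * PowerSeries.C (PowerSeries.coeff e F) ∈ V := by
    have := V.sub_mem hGV hd
    simpa using this
  exact he1 ((V.unit_mul_mem_iff_mem hu).1 h5)

theorem compactness {n : ℕ} [NeZero n] {Q : Set (Rn n)} (ht : ∀ q ∈ Q, tmul n 1 q ∈ Q)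
    (S : Set (ZMod n))
    (h : ∀ L : ℕ, ∃ q ∈ Q, (∀ j : ℤ, j < -(L : ℤ) → q j = 0) ∧ q (-(L : ℤ)) ∈ S) :
    ∃ f ∈ VV n Q, PowerSeries.coeff 0 f ∈ S := by
  letI : TopologicalSpace (ZMod n) := ⊥
  haveI : DiscreteTopology (ZMod n) := ⟨rfl⟩
  let A : ℕ → Set (ℕ → ZMod n) := fun L => {f | f 0 ∈ S ∧ ∃ q ∈ Q, (∀ j : ℤ, j < -(L : ℤ) → q j = 0) ∧
    ∀ k : ℕ, k < L → q ((k : ℤ) - L) = f k}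
  have hcl : ∀ L, IsClosed (A L) := by
    intro L
    let r : (ℕ → ZMod n) → (Fin (L + 1) → ZMod n) := fun f i => f i
    have hr : Continuous r := by fun_prop
    have : A L = r ⁻¹' (r '' A L) := by
      apply Set.Subset.antisymm (Set.subset_preimage_image _ _)
      rintro f ⟨g, ⟨hg0, q, hq, h1, h2⟩, hgf⟩
      have e : ∀ k, k < L + 1 → g k = f k := fun k hk => congrFun hgf ⟨k, hk⟩
      refine ⟨by rw [← e 0 (by omega)]; exact hg0, q, hq, h1, fun k hk => ?_⟩
      rw [h2 k hk, e k (by omega)]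
    rw [this]
    exact (isClosed_discrete _).preimage hr
  have hne : (⋂ L, A L).Nonempty := by
    apply IsCompact.nonempty_iInter_of_sequence_nonempty_isCompact_isClosed
    · rintro L f ⟨hf, q, hq, h1, h2⟩
      refine ⟨hf, _, ht q hq, ?_, ?_⟩
      · intro j hj
        rw [tmul_apply', h1 _ (by push_cast; omega)]
      · intro k hk
        rw [tmul_apply', ← h2 k (by omega)]
        congr 1; push_cast; ring
    · intro L
      obtain ⟨q, hq, h1, h2⟩ := h L
      refine ⟨fun k => q ((k : ℤ) - L), ?_, q, hq, h1, fun k _ => rfl⟩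
      simpa using h2
    · exact (hcl 0).isCompact
    · exact hcl
  obtain ⟨f, hf⟩ := hne
  rw [Set.mem_iInter] at hf
  refine ⟨PowerSeries.mk f, fun L => ?_, ?_⟩
  · obtain ⟨_, q, hq, h1, h2⟩ := hf L
    exact ⟨q, hq, h1, fun k hk => by rw [h2 k hk, PowerSeries.coeff_mk]⟩
  · rw [PowerSeries.coeff_mk]; exact (hf 0).1

theorem exists_low {n : ℕ} (p : Rn n) : ∃ M : ℕ, ∀ j : ℤ, j < -(M : ℤ) → p j = 0 := by
  refine ⟨p.support.sup Int.natAbs, fun j hj => ?_⟩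
  by_contra h
  have := Finset.le_sup (f := Int.natAbs) (Finsupp.mem_support_iff.2 h)
  omega

theorem shiftN {n : ℕ} {Q : Set (Rn n)} (ht : ∀ q ∈ Q, tmul n 1 q ∈ Q) (m : ℕ) :
    ∀ q ∈ Q, tmul n m q ∈ Q := by
  induction m with
  | zero =>
    intro q hq
    have : tmul n (0 : ℕ) q = q := by ext j; simp [tmul_apply']
    rwa [this]
  | succ m ih =>
    intro q hq
    have : tmul n (m + 1 : ℕ) q = tmul n 1 (tmul n m q) := by
      ext j; simp only [tmul_apply']; congr 1; push_cast; ring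
    rw [this]
    exact ht _ (ih q hq)

/-- If `t` strictly confines `R` into `Q`, `B₊ ⊆ Q`, and `H` is the
subgroup of `ℤ_n` generated by the coefficients appearing with arbitrarily small
negative exponents in elements of `Q`, then `Q̃_H ⊆ Q`. -/
theorem QtildeH_subset_Q (n : ℕ) (hn : 2 ≤ n) (Q : Set (Rn n))
    (hQ : StrictlyConfinesT n Q) (hB : Bplus n ⊆ Q) :
    QtildeH n (Hgen n Q) ⊆ Q := by
  classical
  obtain ⟨⟨ht, -, n₀, h0⟩, -⟩ := hQ
  haveI : NeZero n := ⟨by omega⟩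
  set V := VI hB ht n₀ h0 with hV
  have hVm : ∀ f, f ∈ V ↔ f ∈ VV n Q := fun f => Iff.rfl
  set I : Ideal (ZMod n) := V.comap (PowerSeries.C (R := ZMod n)) with hI
  have hsat : ∀ f ∈ V, ∀ k, PowerSeries.coeff k f ∈ I :=
    sat_ideal V (fun f hf => VV_unX hf)
  have hH : Hgen n Q ≤ I.toAddSubgroup := by
    refine (AddSubgroup.closure_le _).2 fun g hg => ?_
    change g ∈ I
    by_contra hgI
    obtain ⟨f, hf, hf0⟩ := compactness ht {c | c ∉ I} (by
      intro L
      obtain ⟨p, hp, i, hi, hpi⟩ := hg (L + n₀ + 1)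
      obtain ⟨M, hM⟩ := exists_low p
      have hex : ∃ k : ℕ, p ((k : ℤ) - M) ∉ I := by
        refine ⟨M - i, ?_⟩
        have hiM : i ≤ M := by
          by_contra hlt
          rw [hM _ (by omega)] at hpi
          exact hgI (hpi ▸ I.zero_mem)
        rw [Nat.cast_sub hiM]
        have : (M : ℤ) - i - M = -i := by ring
        rwa [this, hpi]
      have hiM : i ≤ M := by
        by_contra hlt
        rw [hM _ (by omega)] at hpi
        exact hgI (hpi ▸ I.zero_mem)
      set e := Nat.find hex with he
      have he1 : p ((e : ℤ) - M) ∉ I := Nat.find_spec hex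
      have he2 : ∀ k < e, p ((k : ℤ) - M) ∈ I := fun k hk => by
        simpa using Nat.find_min hex hk
      have heM : e ≤ M - i := by
        refine Nat.find_min' hex ?_
        rw [Nat.cast_sub hiM]
        have : (M : ℤ) - i - M = -i := by ring
        rwa [this, hpi]
      have hfV : (PowerSeries.mk fun k : ℕ => if k < e then - p ((k : ℤ) - M) else 0) ∈ V := by
        apply mem_of_coeffs
        intro k
        rw [PowerSeries.coeff_mk]
        change _ ∈ I
        split_ifs with hk
        · exact I.neg_mem (he2 k hk)
        · exact I.zero_mem
      obtain ⟨q, hq, h1, h2⟩ := hfV M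
      have hs := shiftN ht (M - e - n₀ - L) _ (h0 p hp q hq)
      have hd : ((M - e - n₀ - L : ℕ) : ℤ) = (M : ℤ) - e - n₀ - L := by omega
      refine ⟨_, hs, ?_, ?_⟩
      · intro j hj
        rw [tmul_apply', tmul_apply', hd, Finsupp.add_apply]
        set j' := j - ((M : ℤ) - e - n₀ - L) - n₀ with hj'
        by_cases hlow : j' < -(M : ℤ)
        · rw [hM _ hlow, h1 _ hlow, add_zero]
        · obtain ⟨k, hk⟩ := Int.eq_ofNat_of_zero_le (a := j' + M) (by omega)
          have e1 : j' = (k : ℤ) - M := by omega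
          have hke : k < e := by omega
          rw [e1, h2 k (by omega), PowerSeries.coeff_mk, if_pos hke, add_neg_cancel]
      · rw [tmul_apply', tmul_apply', hd, Finsupp.add_apply]
        have e1 : -(L : ℤ) - ((M : ℤ) - e - n₀ - L) - n₀ = e - M := by ring
        rw [e1]
        have heM2 : e < M := by omega
        rw [h2 e heM2, PowerSeries.coeff_mk, if_neg (lt_irrefl _), add_zero]
        exact he1)
    exact hf0 (hsat f hf 0)
  rintro p ⟨hp1, hp2⟩
  obtain ⟨M, hM⟩ := exists_low p
  have hfV : (PowerSeries.mk fun k : ℕ => p ((k : ℤ) - M)) ∈ V := by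
    apply mem_of_coeffs
    intro k
    rw [PowerSeries.coeff_mk]
    change _ ∈ I
    by_cases hk : (k : ℤ) - M < 0
    · have := hH (hp1 (M - k) (by omega))
      rw [neg_sub] at this
      exact this
    · rw [hp2 _ (by omega)]; exact I.zero_mem
  obtain ⟨q, hq, h1, h2⟩ := hfV (M + n₀)
  have hb : tmul n (-n₀) p - q ∈ Bplus n := by
    intro j hj
    rw [Finsupp.sub_apply, tmul_apply']
    by_cases hlow : j < -((M + n₀ : ℕ) : ℤ)
    · rw [h1 j hlow, hM _ (by push_cast at hlow; omega), sub_zero]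
    · obtain ⟨k, hk⟩ := Int.eq_ofNat_of_zero_le (a := j + (M + n₀ : ℕ)) (by omega)
      have e1 : j = (k : ℤ) - (M + n₀ : ℕ) := by omega
      rw [e1, h2 k (by omega), PowerSeries.coeff_mk, sub_eq_zero]
      congr 1; push_cast; ring
  have := h0 q hq _ (hB hb)
  rw [add_sub_cancel] at this
  have e2 : tmul n n₀ (tmul n (-n₀) p) = p := by
    ext j; simp [tmul_apply']
  rwa [e2] at this
end

section
/- Let G = ℤ₂ × ℤ₂ and let A be the group of finitely supported functions ℤ → G under pointwise addition, with shift t. For i ≥ 2 let p_i ∈ A be the element (0,1)t^{−i} + (1,0)t^{−i+1} (value (0,1) at −i, value (1,0) at −i+1, zero elsewhere), and let Q = { Σ_{k=1}^{m} t^{j_k}·p_{i_k} + b : m ≥ 0, j_k ≥ 0, i_k ≥ 2, b ∈ B₊ }, where B₊ is the set of elements of A supported on nonnegative integers. Then the action of t strictly confines A into Q: (a) t·Q is a proper subset of Q — in particular (1,0)t⁰ ∈ Q but (1,0)t^{−1} ∉ Q; (b) for every f ∈ A there exists m ≥ 0 with t^m·f ∈ Q; (c) Q + Q ⊆ Q.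 -/
open Function Set Pointwise

/-- `A = ⊕_{i∈ℤ} (ℤ₂ × ℤ₂)`: finitely supported functions `ℤ → ℤ₂ × ℤ₂`. -/
abbrev A2 := ℤ →₀ (ZMod 2 × ZMod 2)

/-- The shift by `m`: `t^m·(g tʲ) = g t^{j+m}`. -/
def tmul2 (m : ℤ) : A2 ≃+ A2 := Finsupp.domCongr (Equiv.addRight m)

/-- `B₊`: the set of elements of `A` supported on nonnegative integers. -/
def Bplus2 : Set A2 := {p | ∀ i : ℤ, i < 0 → p i = 0}

/-- `p_i = (0,1)t^{−i} + (1,0)t^{−i+1}`. -/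
noncomputable def pelt (i : ℤ) : A2 :=
  Finsupp.single (-i) ((0, 1) : ZMod 2 × ZMod 2) +
    Finsupp.single (-i + 1) ((1, 0) : ZMod 2 × ZMod 2)

/-- `Q = { Σ_k t^{j_k}·p_{i_k} + b : j_k ≥ 0, i_k ≥ 2, b ∈ B₊ }`. -/
def Qex : Set A2 :=
  {q | ∃ (m : ℕ) (j : Fin m → ℕ) (idx : Fin m → ℤ), (∀ k, 2 ≤ idx k) ∧
    ∃ b ∈ Bplus2, q = (∑ k, tmul2 (j k : ℤ) (pelt (idx k))) + b}

theorem tmul2_app (m : ℤ) (f : A2) (i : ℤ) : tmul2 m f i = f (i - m) := by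
  simp [tmul2, Finsupp.domCongr, Finsupp.equivMapDomain_apply, sub_eq_add_neg]

theorem tmul2_tmul2 (m n : ℤ) (f : A2) : tmul2 m (tmul2 n f) = tmul2 (n + m) f := by
  ext1 i
  rw [tmul2_app, tmul2_app, tmul2_app]
  congr 1
  ring

theorem Bplus_sub {b : A2} (hb : b ∈ Bplus2) : b ∈ Qex :=
  ⟨0, Fin.elim0, Fin.elim0, fun k => k.elim0, b, hb, by simp⟩

theorem pelt_inv (k n : ℤ) : (pelt k n).2 = (pelt k (n + 1)).1 := by
  simp only [pelt, Finsupp.add_apply, Finsupp.single_apply, Prod.fst_add, Prod.snd_add]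
  by_cases h : -k = n
  · simp [h]
  · have h2 : ¬ (-k + 1 = n + 1) := by omega
    rw [if_neg h, if_neg h2]
    split_ifs <;> simp

theorem Qex_inv {q : A2} (hq : q ∈ Qex) (n : ℤ) (hn : n ≤ -2) : (q n).2 = (q (n + 1)).1 := by
  obtain ⟨m, j, idx, -, b, hb, rfl⟩ := hq
  rw [Finsupp.add_apply, Finsupp.add_apply, hb n (by omega), hb (n + 1) (by omega)]
  simp only [Finsupp.finsetSum_apply, add_zero, Prod.fst_sum, Prod.snd_sum]
  refine Finset.sum_congr rfl fun k _ => ?_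
  rw [tmul2_app, tmul2_app, pelt_inv,
    show n - (j k : ℤ) + 1 = n + 1 - (j k : ℤ) by ring]

theorem not_mem_aux : Finsupp.single (-1 : ℤ) ((1, 0) : ZMod 2 × ZMod 2) ∉ Qex := by
  intro h
  have := Qex_inv h (-2) le_rfl
  simp [Finsupp.single_apply] at this

theorem mem_aux : Finsupp.single (0 : ℤ) ((1, 0) : ZMod 2 × ZMod 2) ∈ Qex := by
  apply Bplus_sub
  intro i hi
  exact Finsupp.single_eq_of_ne (by omega)

theorem shift_sub : ⇑(tmul2 1) '' Qex ⊆ Qex := by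
  rintro _ ⟨_, ⟨m, j, idx, hidx, b, hb, rfl⟩, rfl⟩
  refine ⟨m, fun k => j k + 1, idx, hidx, tmul2 1 b, ?_, ?_⟩
  · intro i hi
    rw [tmul2_app]
    exact hb _ (by omega)
  · rw [map_add, map_sum]
    congr 1
    refine Finset.sum_congr rfl fun k _ => ?_
    rw [tmul2_tmul2]
    push_cast
    rfl

theorem klein_strictly_confining :
    (⇑(tmul2 1) '' Qex ⊂ Qex ∧
      Finsupp.single (0 : ℤ) ((1, 0) : ZMod 2 × ZMod 2) ∈ Qex ∧
      Finsupp.single (-1 : ℤ) ((1, 0) : ZMod 2 × ZMod 2) ∉ Qex) ∧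
    (∀ f : A2, ∃ m : ℕ, tmul2 (m : ℤ) f ∈ Qex) ∧
    (∀ q₁ ∈ Qex, ∀ q₂ ∈ Qex, q₁ + q₂ ∈ Qex) := by
  refine ⟨⟨⟨shift_sub, ?_⟩, mem_aux, not_mem_aux⟩, ?_, ?_⟩
  · intro h
    obtain ⟨q, hq, he⟩ := h mem_aux
    apply not_mem_aux
    have : q = Finsupp.single (-1 : ℤ) ((1, 0) : ZMod 2 × ZMod 2) := by
      apply (tmul2 1).injective
      rw [he]
      ext1 i
      rw [tmul2_app, Finsupp.single_apply, Finsupp.single_apply]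
      congr 1
      apply propext
      omega
    exact this ▸ hq
  · intro f
    refine ⟨∑ i ∈ f.support, i.natAbs, Bplus_sub ?_⟩
    intro i hi
    rw [tmul2_app]
    by_contra hne
    have h1 := Finset.single_le_sum (f := fun i : ℤ => i.natAbs) (fun _ _ => Nat.zero_le _)
      (Finsupp.mem_support_iff.2 hne)
    simp only at h1
    omega
  · rintro _ ⟨m, j, idx, hidx, b, hb, rfl⟩ _ ⟨m', j', idx', hidx', b', hb', rfl⟩
    refine ⟨m + m', Fin.append j j', Fin.append idx idx', ?_, b + b', ?_, ?_⟩
    · intro k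
      refine Fin.addCases (fun k => ?_) (fun k => ?_) k
      · simpa using hidx k
      · simpa using hidx' k
    · intro i hi
      rw [Finsupp.add_apply, hb i hi, hb' i hi, add_zero]
    · rw [Fin.sum_univ_add]
      simp only [Fin.append_left, Fin.append_right]
      abel
end

section
/- Let G = ℤ₂ × ℤ₂, let p_i = (0,1)t^{−i} + (1,0)t^{−i+1} ∈ A for i ≥ 2, and let Q be as in the preceding construction (the set of finite sums Σ t^{j_k}·p_{i_k} + b with j_k ≥ 0, i_k ≥ 2, b ∈ B₊). Then for every proper subgroup H of ℤ₂ × ℤ₂ and every N ∈ ℕ there exists i ≥ 2 such that p_i, viewed as an element of the wreath product (ℤ₂ × ℤ₂) wr ℤ, is not a product of at most N elements of S_H ∪ S_H⁻¹, where S_H = Q_H ∪ {t, t⁻¹} and Q_H = {f ∈ A : f(−i) ∈ H for all i > 0}; whereas every p_i lies in Q. In particular the generating set X = Q ∪ {t, t⁻¹} of (ℤ₂ × ℤ₂) wr ℤ is not bi-Lipschitz equivalent to S_H for any proper subgroup H of ℤ₂ × ℤ₂. -/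
open Function Set Pointwise

/-- The wreath product `(ℤ₂ × ℤ₂) wr ℤ = A ⋊ ℤ`, where `t` acts by the shift. -/
abbrev W2 := SemidirectProduct (Multiplicative A2) (Multiplicative ℤ)
  (zpowersHom (MulAut (Multiplicative A2)) (AddEquiv.toMultiplicative (tmul2 1)))

/-- The element `t` of the wreath product. -/
noncomputable def tW2 : W2 := SemidirectProduct.inr (Multiplicative.ofAdd (1 : ℤ))

/-- The embedding of the base `A` into the wreath product. -/
noncomputable def ι2 (p : A2) : W2 := SemidirectProduct.inl (Multiplicative.ofAdd p)

/-- `Q_H = {f ∈ A : f(−i) ∈ H for all i > 0}`. -/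
def QH2 (H : AddSubgroup (ZMod 2 × ZMod 2)) : Set A2 :=
  {f | ∀ i : ℤ, 1 ≤ i → f (-i) ∈ H}

/-- the generating set `S_H = Q_H ∪ {t, t⁻¹}`. -/
noncomputable def SH2 (H : AddSubgroup (ZMod 2 × ZMod 2)) : Set W2 :=
  (ι2 '' QH2 H) ∪ {tW2, tW2⁻¹}

theorem SH2_cases (H : AddSubgroup (ZMod 2 × ZMod 2)) (x : W2) (hx : x ∈ SH2 H ∪ (SH2 H)⁻¹) :
    (∃ q ∈ QH2 H, x = ι2 q) ∨ x = tW2 ∨ x = tW2⁻¹ := by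
  rcases hx with hx | hx
  · rcases hx with ⟨q, hq, rfl⟩ | hx | hx
    · exact Or.inl ⟨q, hq, rfl⟩
    · exact Or.inr (Or.inl hx)
    · exact Or.inr (Or.inr hx)
  · rw [Set.mem_inv] at hx
    rcases hx with ⟨q, hq, hx⟩ | hx | hx
    · refine Or.inl ⟨-q, fun i hi => ?_, ?_⟩
      · simpa using hq i hi
      · rw [← inv_inv x, ← hx]
        simp [ι2]
    · refine Or.inr (Or.inr ?_)
      rw [← inv_inv x, hx]
    · refine Or.inr (Or.inl ?_)
      exact inv_injective hx

theorem left_ι2_mul (q : A2) (w : W2) (i : ℤ) :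
    (ι2 q * w).left.toAdd i = q i + w.left.toAdd i := by
  simp [ι2]

theorem left_t_mul (w : W2) (i : ℤ) :
    (tW2 * w).left.toAdd i = w.left.toAdd (i - 1) := by
  have h : (tW2 * w).left = AddEquiv.toMultiplicative (tmul2 1) w.left := by
    rw [SemidirectProduct.mul_left]
    simp [tW2]
  rw [h]
  rfl

theorem left_tinv_mul (w : W2) (i : ℤ) :
    (tW2⁻¹ * w).left.toAdd i = w.left.toAdd (i + 1) := by
  have := left_t_mul (tW2⁻¹ * w) (i + 1)
  rw [mul_inv_cancel_left] at this
  rw [this]; congr 1; ring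

theorem SH2_list_prod_mem (H : AddSubgroup (ZMod 2 × ZMod 2)) (l : List W2)
    (hl : ∀ x ∈ l, x ∈ SH2 H ∪ (SH2 H)⁻¹) :
    ∀ i : ℤ, i < -(l.length : ℤ) → l.prod.left.toAdd i ∈ H := by
  induction l with
  | nil => intro i _; simp
  | cons x l ih =>
    intro i hi
    have ih := ih (fun y hy => hl y (List.mem_cons_of_mem _ hy))
    rw [List.length_cons] at hi
    push_cast at hi
    rw [List.prod_cons]
    rcases SH2_cases H x (hl x List.mem_cons_self) with ⟨q, hq, rfl⟩ | rfl | rfl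
    · rw [left_ι2_mul]
      refine H.add_mem ?_ (ih i (by omega))
      have := hq (-i) (by omega)
      rwa [neg_neg] at this
    · rw [left_t_mul]; exact ih _ (by omega)
    · rw [left_tinv_mul]; exact ih _ (by omega)

/-- Every `p_i` (for `i ≥ 2`) lies in `Q`, but for every proper
subgroup `H < ℤ₂ × ℤ₂` and every `N` some `p_i` is not a product of at most `N` elements
of `S_H ∪ S_H⁻¹` in `(ℤ₂ × ℤ₂) wr ℤ`. In particular `X = Q ∪ {t, t⁻¹}` is not
bi-Lipschitz equivalent to any `S_H`. -/
theorem klein_Q_not_equivalent_to_any_SH :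
    (∀ i : ℤ, 2 ≤ i → pelt i ∈ Qex) ∧
    (∀ H : AddSubgroup (ZMod 2 × ZMod 2), H ≠ ⊤ → ∀ N : ℕ, ∃ i : ℤ, 2 ≤ i ∧
      ι2 (pelt i) ∉ wordBall (SH2 H) N) := by
  constructor
  · intro i hi
    refine ⟨1, fun _ => 0, fun _ => i, fun _ => hi, 0, fun _ _ => rfl, ?_⟩
    have h : tmul2 0 (pelt i) = pelt i := by
      ext1 j
      change pelt i (j + -0) = pelt i j
      simp
    simp [h]
  · rintro H hH N
    refine ⟨N + 2, by omega, ?_⟩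
    rintro ⟨l, hlen, hl, hp⟩
    have key := SH2_list_prod_mem H l hl
    rw [hp] at key
    have h1 : ((0, 1) : ZMod 2 × ZMod 2) ∈ H := by
      have := key (-(N + 2)) (by omega)
      simpa [ι2, pelt, Finsupp.single_apply] using this
    have h2 : ((1, 0) : ZMod 2 × ZMod 2) ∈ H := by
      have := key (-(N + 2) + 1) (by omega)
      simpa [ι2, pelt, Finsupp.single_apply] using this
    apply hH
    rw [eq_top_iff]
    rintro ⟨a, b⟩ -
    have h0 := H.zero_mem
    have h3 := H.add_mem h1 h2
    fin_cases a <;> fin_cases b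
    · exact h0
    · exact h1
    · exact h2
    · exact h3
end
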